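/- Let (Ω,𝒜,T,μ,ℱ,‖·‖,χ) fulfill Property 𝔇 with μ(χ>x)=L(x)/x^α for all x>0, L slowly varying, 0<α<1; let (b_n) be natural numbers tending to infinity with b_n=o(n); put ζ_n := b_n^{2/3}, g_n := F^←(1−(b_n−ζ_n)/n); assume ψ(r)<1 where r := min{n∈ℕ : ψ(n)<1}, and define Φ'_{k,n} := { #{ j≤n : χ∘T^{j-1} > 2^{k-1}·g_n } > b_n − 2r + 1 }. Then there exist constants K>0, W>0 and N∈ℕ such that for all n≥N and all integers k≥2: μ(Φ'_{k,n}) ≤ K·exp(−W·b_n). -/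

import Mathlib

open MeasureTheory Filter Topology ENNReal

noncomputable section

/-- Birkhoff sum `S_n χ = ∑_{k=1}^n χ ∘ T^{k-1}`. -/
def birkhoffSumN {Ω : Type*} (T : Ω → Ω) (χ : Ω → ℝ) (n : ℕ) (ω : Ω) : ℝ :=
  ∑ k ∈ Finset.range n, χ (T^[k] ω)

/-- Trimmed sum `S_n^b χ`: the sum of the `n - b` smallest values among
`χ(ω), χ(Tω), …, χ(T^{n-1}ω)`. -/
def trimmedSumN {Ω : Type*} (T : Ω → Ω) (χ : Ω → ℝ) (n b : ℕ) (ω : Ω) : ℝ :=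
  (((((List.range n).map fun k => χ (T^[k] ω))).mergeSort (fun a b => a ≤ b)).take (n - b)).sum

/-- Truncated sum `T_n^f χ = ∑_{k=1}^n (χ·1_{χ ≤ f}) ∘ T^{k-1}`. -/
def truncSumN {Ω : Type*} (T : Ω → Ω) (χ : Ω → ℝ) (n : ℕ) (f : ℝ) (ω : Ω) : ℝ :=
  ∑ k ∈ Finset.range n, if χ (T^[k] ω) ≤ f then χ (T^[k] ω) else 0

/-- A function `L` is slowly varying if `L(cx)/L(x) → 1` as `x → ∞`, for every `c > 0`. -/
def SlowlyVarying (L : ℝ → ℝ) : Prop :=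
  ∀ c : ℝ, 0 < c → Tendsto (fun x => L (c * x) / L x) atTop (𝓝 1)

/-- `ls` is a de Bruijn conjugate of the slowly varying function `Lt`. -/
def IsDeBruijnConjugate (Lt ls : ℝ → ℝ) : Prop :=
  SlowlyVarying ls ∧
  Tendsto (fun x => Lt x * ls (x * Lt x)) atTop (𝓝 1) ∧
  Tendsto (fun x => ls x * Lt (x * ls x)) atTop (𝓝 1)

/-- The measure of dependence `ψ(ℬ,𝒞)` between two sub-σ-fields. -/
def psiDep {Ω : Type*} [MeasurableSpace Ω] (μ : Measure Ω)
    (B C : MeasurableSpace Ω) : ℝ≥0∞ :=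
  ⨆ (b : Set Ω) (c : Set Ω) (_ : MeasurableSet[B] b) (_ : MeasurableSet[C] c)
    (_ : 0 < μ b) (_ : 0 < μ c),
    ENNReal.ofReal |(μ (b ∩ c)).toReal / ((μ b).toReal * (μ c).toReal) - 1|

/-- The σ-field generated by `X_k = χ ∘ T^{k-1}` for `J ≤ k ≤ L`. -/
def sigmaIcc {Ω : Type*} [MeasurableSpace Ω] (T : Ω → Ω) (χ : Ω → ℝ) (J L : ℕ) :
    MeasurableSpace Ω :=
  ⨆ k ∈ Set.Icc J L, MeasurableSpace.comap (fun ω => χ (T^[k - 1] ω)) inferInstance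

/-- The σ-field generated by `X_k = χ ∘ T^{k-1}` for `k ≥ J`. -/
def sigmaIci {Ω : Type*} [MeasurableSpace Ω] (T : Ω → Ω) (χ : Ω → ℝ) (J : ℕ) :
    MeasurableSpace Ω :=
  ⨆ k ∈ Set.Ici J, MeasurableSpace.comap (fun ω => χ (T^[k - 1] ω)) inferInstance

/-- The `n`-th ψ-mixing coefficient of the sequence `(χ ∘ T^{k-1})_{k ≥ 1}`. -/
def psiCoeff {Ω : Type*} [MeasurableSpace Ω] (μ : Measure Ω) (T : Ω → Ω) (χ : Ω → ℝ)
    (n : ℕ) : ℝ≥0∞ :=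
  ⨆ (k : ℕ) (_ : 1 ≤ k), psiDep μ (sigmaIcc T χ 1 k) (sigmaIci T χ (k + n))

/-- A bounded operator `U` has a spectral gap: `U = λ·P + N` with `P` a one-dimensional
projection, `ρ(N) < |λ|`, and `PN = NP = 0`. -/
def HasSpectralGap {F : Type*} [NormedAddCommGroup F] [NormedSpace ℝ F] [CompleteSpace F]
    (U : F →L[ℝ] F) : Prop :=
  ∃ (lam : ℝ) (P N : F →L[ℝ] F),
    U = lam • P + N ∧ P.comp P = P ∧
    Module.finrank ℝ (LinearMap.range (P : F →ₗ[ℝ] F)) = 1 ∧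
    spectralRadius ℝ N < ENNReal.ofReal |lam| ∧
    P.comp N = 0 ∧ N.comp P = 0

/-- Property ℭ: `μ` is a `T`-invariant mixing probability measure, `ℱ` (realized as a Banach
algebra `F` of measurable functions via the injective algebra homomorphism `ι`) contains the
constants, dominates the sup norm, and the transfer operator restricts to a bounded operator
on `F` with a spectral gap. -/
structure PropertyC {Ω : Type*} [MeasurableSpace Ω] (T : Ω → Ω) (μ : Measure Ω)
    {F : Type*} [NormedRing F] [NormedAlgebra ℝ F] [CompleteSpace F]
    (ι : F →ₐ[ℝ] Ω → ℝ) : Prop where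
  prob : IsProbabilityMeasure μ
  invariant : MeasurePreserving T μ μ
  mixing : ∀ A B : Set Ω, MeasurableSet A → MeasurableSet B →
    Tendsto (fun n => μ (A ∩ T^[n] ⁻¹' B)) atTop (𝓝 (μ A * μ B))
  inj : Function.Injective ι
  measurable_mem : ∀ f : F, Measurable (ι f)
  norm_ge_sup : ∀ (f : F) (ω : Ω), |ι f ω| ≤ ‖f‖
  transfer : ∃ That : F →L[ℝ] F,
    (∀ (f : F) (g : Ω → ℝ), Measurable g → (∃ C, ∀ ω, |g ω| ≤ C) →
      ∫ ω, ι (That f) ω * g ω ∂μ = ∫ ω, ι f ω * g (T ω) ∂μ) ∧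
    HasSpectralGap That

/-- Property 𝔇: Property ℭ together with the norm control on truncations of the
nonnegative observable `χ`. -/
structure PropertyD {Ω : Type*} [MeasurableSpace Ω] (T : Ω → Ω) (μ : Measure Ω)
    {F : Type*} [NormedRing F] [NormedAlgebra ℝ F] [CompleteSpace F]
    (ι : F →ₐ[ℝ] Ω → ℝ) (χ : Ω → ℝ) extends PropertyC T μ ι : Prop where
  chi_nonneg : ∀ ω, 0 ≤ χ ω
  chi_meas : Measurable χ
  norm_bound : ∃ K₁ > (0 : ℝ), ∀ ℓ : ℝ, 0 ≤ ℓ →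
    (∃ f : F, ι f = (fun ω => if χ ω ≤ ℓ then χ ω else 0) ∧ ‖f‖ ≤ K₁ * ℓ) ∧
    (∃ g : F, ι g = (fun ω => if ℓ < χ ω then (1 : ℝ) else 0) ∧ ‖g‖ ≤ K₁)

/-- The distribution function `F(x) = μ(χ ≤ x)`. -/
def distF {Ω : Type*} [MeasurableSpace Ω] (μ : Measure Ω) (χ : Ω → ℝ) (x : ℝ) : ℝ :=
  (μ {ω | χ ω ≤ x}).toReal

/-- Generalized inverse `F^←(y) = inf {x | F(x) ≥ y}`. -/
def genInv (F : ℝ → ℝ) (y : ℝ) : ℝ := sInf {x : ℝ | y ≤ F x}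

/-- `g_n = F^←(1 - (b_n - ζ_n)/n)` where `ζ_n = b_n^{2/3}`. -/
def gSeq {Ω : Type*} [MeasurableSpace Ω] (μ : Measure Ω) (χ : Ω → ℝ) (b : ℕ → ℕ)
    (n : ℕ) : ℝ :=
  genInv (distF μ χ) (1 - ((b n : ℝ) - (b n : ℝ) ^ ((2 : ℝ) / 3)) / n)

/-- The norming sequence `d_n = (α/(1-α))·n^{1/α}·b_n^{1-1/α}·ℓ^#((n/b_n)^{1/α})`. -/
def dSeq (α : ℝ) (ls : ℝ → ℝ) (b : ℕ → ℕ) (n : ℕ) : ℝ :=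
  α / (1 - α) * (n : ℝ) ^ (1 / α) * (b n : ℝ) ^ (1 - 1 / α) *
    ls (((n : ℝ) / (b n : ℝ)) ^ (1 / α))

end


/-! ### Window sigma-fields -/

/-- The sigma-field generated by `χ ∘ T^j` for `j ∈ S` (zero-based indices). -/
def winV {Ω : Type*} (T : Ω → Ω) (χ : Ω → ℝ) (S : Set ℕ) : MeasurableSpace Ω :=
  ⨆ k ∈ S, MeasurableSpace.comap (fun ω => χ (T^[k] ω)) inferInstance

theorem winV_mono {Ω : Type*} (T : Ω → Ω) (χ : Ω → ℝ) {S S' : Set ℕ} (h : S ⊆ S') :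
    winV T χ S ≤ winV T χ S' :=
  biSup_mono h

theorem winV_le {Ω : Type*} [mΩ : MeasurableSpace Ω] {T : Ω → Ω} {χ : Ω → ℝ}
    (hT : Measurable T) (hχ : Measurable χ) (S : Set ℕ) : winV T χ S ≤ mΩ :=
  iSup₂_le fun k _ => measurable_iff_comap_le.1 (hχ.comp (hT.iterate k))

theorem winV_preimage {Ω : Type*} (T : Ω → Ω) (χ : Ω → ℝ) (i : ℕ) {S S' : Set ℕ}
    (hS : ∀ j ∈ S, j + i ∈ S') {A : Set Ω} (hA : MeasurableSet[winV T χ S] A) :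
    MeasurableSet[winV T χ S'] (T^[i] ⁻¹' A) := by
  have h : winV T χ S ≤ MeasurableSpace.map (T^[i]) (winV T χ S') := by
    refine iSup₂_le fun k hk => ?_
    rw [← MeasurableSpace.comap_le_iff_le_map, MeasurableSpace.comap_comp]
    refine le_trans (le_of_eq ?_) (le_iSup₂ (f := fun k (_ : k ∈ S') =>
      MeasurableSpace.comap (fun ω => χ (T^[k] ω)) inferInstance) (k + i) (hS k hk))
    congr 1
    funext ω
    simp [Function.iterate_add_apply]
  exact h A hA

theorem winV_gt {Ω : Type*} (T : Ω → Ω) (χ : Ω → ℝ) (x : ℝ) {S : Set ℕ} {j : ℕ} (hj : j ∈ S) :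
    MeasurableSet[winV T χ S] {ω | x < χ (T^[j] ω)} := by
  have h := le_iSup₂ (f := fun k (_ : k ∈ S) =>
      MeasurableSpace.comap (fun ω => χ (T^[k] ω)) inferInstance) j hj
  exact h _ ⟨Set.Ioi x, measurableSet_Ioi, rfl⟩

/-- Comparison of integrals over an event with integrals over the whole space. -/
theorem setIntegral_le_of_ratio {Ω : Type*} {m mΩ : MeasurableSpace Ω} (hm : m ≤ mΩ)
    {μ : Measure Ω} [IsProbabilityMeasure μ] {B : Set Ω} {c : ℝ} (hc : 0 ≤ c)
    (h : ∀ S, MeasurableSet[m] S → μ.real (S ∩ B) ≤ c * μ.real S)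
    {f : Ω → ℝ} (hf : Measurable[m] f) (hf0 : ∀ ω, 0 ≤ f ω) (hfi : Integrable f μ) :
    ∫ ω in B, f ω ∂μ ≤ c * ∫ ω, f ω ∂μ := by
  have hg : Measurable[m] fun ω => ENNReal.ofReal (f ω) := hf.ennreal_ofReal
  have hle : (μ.restrict B).trim hm ≤ (ENNReal.ofReal c • μ).trim hm := by
    refine Measure.le_iff.2 fun S hS => ?_
    rw [trim_measurableSet_eq hm hS, trim_measurableSet_eq hm hS, Measure.restrict_apply (hm S hS)]
    have := h S hS
    rw [Measure.smul_apply, smul_eq_mul, ← ofReal_measureReal (μ := μ) (s := S ∩ B),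
      ← ofReal_measureReal (μ := μ) (s := S), ← ENNReal.ofReal_mul hc]
    exact ENNReal.ofReal_le_ofReal this
  have hl : ∫⁻ ω, ENNReal.ofReal (f ω) ∂(μ.restrict B)
      ≤ ENNReal.ofReal c * ∫⁻ ω, ENNReal.ofReal (f ω) ∂μ := by
    rw [← lintegral_trim hm hg, ← smul_eq_mul, ← lintegral_smul_measure, ← lintegral_trim hm hg]
    exact lintegral_mono' hle le_rfl
  rw [integral_eq_lintegral_of_nonneg_ae (ae_of_all _ hf0) hfi.aestronglyMeasurable.restrict,
    integral_eq_lintegral_of_nonneg_ae (ae_of_all _ hf0) hfi.aestronglyMeasurable]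
  have hfin : ∫⁻ ω, ENNReal.ofReal (f ω) ∂μ ≠ ⊤ := by
    exact hfi.lintegral_lt_top.ne
  calc _ ≤ (ENNReal.ofReal c * ∫⁻ ω, ENNReal.ofReal (f ω) ∂μ).toReal :=
        ENNReal.toReal_mono (ENNReal.mul_ne_top ENNReal.ofReal_ne_top hfin) hl
    _ = _ := by rw [ENNReal.toReal_mul, ENNReal.toReal_ofReal hc]

theorem measurable_indicator_sub {Ω : Type*} {m : MeasurableSpace Ω} {E : Set Ω}
    (hE : MeasurableSet E) (p : ℝ) : Measurable fun ω => E.indicator (1 : Ω → ℝ) ω - p :=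
  (measurable_one.indicator hE).sub measurable_const

theorem measurable_abs_comp {Ω : Type*} {m : MeasurableSpace Ω} {f : Ω → ℝ}
    (hf : Measurable f) : Measurable fun ω => |f ω| :=
  continuous_abs.measurable.comp hf

/-- Nearly uncorrelated events are, on average, nearly uncorrelated with any event of bounded
dependence ratio. -/
theorem sum_abs_le_of_decor {Ω : Type*} {m mΩ : MeasurableSpace Ω} (hm : m ≤ mΩ)
    {μ : Measure Ω} [IsProbabilityMeasure μ] {B : Set Ω} (hB : MeasurableSet B)
    {c : ℝ} (hc : 0 ≤ c)
    (h : ∀ S, MeasurableSet[m] S → μ.real (S ∩ B) ≤ c * μ.real S)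
    (E : ℕ → Set Ω) (hEm : ∀ s, MeasurableSet (E s)) (p : ℝ) (hp : ∀ s, μ.real (E s) = p)
    (M : ℕ) (hE : ∀ s, s < M → MeasurableSet[m] (E s)) (θ : ℝ) (hθ : 0 < θ) (hM : 2 ≤ θ ^ 2 * M)
    (hcor : ∀ s t, s ≠ t → |μ.real (E s ∩ E t) - p ^ 2| ≤ θ ^ 2 / 2) :
    ∑ s ∈ Finset.range M, |μ.real (E s ∩ B) - p * μ.real B| ≤ c * (θ * M) := by
  have hM0 : (0 : ℝ) < M := by
    rcases Nat.eq_zero_or_pos M with h0 | h0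
    · subst h0; norm_num at hM
    · exact_mod_cast h0
  let u : ℕ → Ω → ℝ := fun s ω => (E s).indicator 1 ω - p
  have hp01 : 0 ≤ p ∧ p ≤ 1 := by
    rw [← hp 0]; exact ⟨measureReal_nonneg, measureReal_le_one⟩
  have hub : ∀ s ω, |u s ω| ≤ 1 := by
    intro s ω
    simp only [u]
    by_cases hω : ω ∈ E s <;> simp [hω, abs_le] <;> constructor <;> linarith [hp01.1, hp01.2]
  have hum : ∀ s, s < M → Measurable[m] (u s) := by
    intro s hs
    exact measurable_indicator_sub (hE s hs) p
  have huM : ∀ s, Measurable (u s) := fun s => measurable_indicator_sub (hEm s) p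
  obtain ⟨σ, hσ1, hσ⟩ : ∃ σ : ℕ → ℝ, (∀ s, |σ s| = 1) ∧
      ∀ s, |μ.real (E s ∩ B) - p * μ.real B| = σ s * (μ.real (E s ∩ B) - p * μ.real B) := by
    refine ⟨fun s => if 0 ≤ μ.real (E s ∩ B) - p * μ.real B then 1 else -1, ?_, ?_⟩
    · intro s; dsimp only; split_ifs <;> simp
    · intro s; dsimp only
      split_ifs with h0
      · rw [abs_of_nonneg h0, one_mul]
      · rw [abs_of_neg (not_le.1 h0)]; ring
  let Z : Ω → ℝ := fun ω => ∑ s ∈ Finset.range M, σ s * u s ω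
  have hZm : Measurable[m] Z := by
    refine Finset.measurable_sum _ fun s hs => ?_
    exact measurable_const.mul (hum s (Finset.mem_range.1 hs))
  have hZM : Measurable Z := hZm.mono hm le_rfl
  have hZb : ∀ ω, |Z ω| ≤ M := by
    intro ω
    calc |Z ω| ≤ ∑ s ∈ Finset.range M, |σ s * u s ω| := Finset.abs_sum_le_sum_abs _ _
      _ ≤ ∑ s ∈ Finset.range M, (1 : ℝ) := by
          refine Finset.sum_le_sum fun s _ => ?_
          rw [abs_mul, hσ1, one_mul]; exact hub s ω
      _ = M := by simp
  have hZi : Integrable Z μ :=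
    Integrable.of_bound hZM.aestronglyMeasurable M (ae_of_all _ fun ω => by simpa using hZb ω)
  have hui : ∀ s, Integrable (u s) μ := fun s =>
    Integrable.of_bound (huM s).aestronglyMeasurable 1 (ae_of_all _ fun ω => by simpa using hub s ω)
  have huui : ∀ s t, Integrable (fun ω => u s ω * u t ω) μ := fun s t =>
    Integrable.of_bound ((huM s).mul (huM t)).aestronglyMeasurable 1 (ae_of_all _ fun ω => by
      rw [Real.norm_eq_abs, abs_mul]
      exact mul_le_one₀ (hub s ω) (abs_nonneg _) (hub t ω))
  have hZ2i : Integrable (fun ω => Z ω ^ 2) μ :=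
    Integrable.of_bound (hZM.pow_const 2).aestronglyMeasurable ((M : ℝ) ^ 2)
      (ae_of_all _ fun ω => by
        rw [Real.norm_eq_abs, abs_pow]
        exact pow_le_pow_left₀ (abs_nonneg _) (hZb ω) 2)
  have hindi : ∀ s, Integrable ((E s).indicator (1 : Ω → ℝ)) μ := fun s =>
    (integrable_const (1 : ℝ)).indicator (hEm s)
  -- the second moment
  have hcov : ∀ s t, s ≠ t → |∫ ω, u s ω * u t ω ∂μ| ≤ θ ^ 2 / 2 := by
    intro s t hst
    have e : ∀ ω, u s ω * u t ω = (E s ∩ E t).indicator 1 ω - p * (E s).indicator 1 ω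
        - p * (E t).indicator 1 ω + p ^ 2 := by
      intro ω
      simp only [u]
      by_cases h1 : ω ∈ E s <;> by_cases h2 : ω ∈ E t <;> simp [h1, h2] <;> ring
    have : ∫ ω, u s ω * u t ω ∂μ = μ.real (E s ∩ E t) - p ^ 2 := by
      simp_rw [e]
      have i1 : Integrable ((E s ∩ E t).indicator (1 : Ω → ℝ)) μ :=
        (integrable_const (1 : ℝ)).indicator ((hEm s).inter (hEm t))
      have i2 : Integrable (fun ω => (E s ∩ E t).indicator (1 : Ω → ℝ) ω
          - p * (E s).indicator 1 ω) μ := i1.sub ((hindi s).const_mul p)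
      have i3 : Integrable (fun ω => (E s ∩ E t).indicator (1 : Ω → ℝ) ω
          - p * (E s).indicator 1 ω - p * (E t).indicator 1 ω) μ :=
        i2.sub ((hindi t).const_mul p)
      rw [integral_add i3 (integrable_const _), integral_sub i2
          ((hindi t).const_mul p), integral_sub i1 ((hindi s).const_mul p),
        integral_const_mul, integral_const_mul, integral_indicator_one ((hEm s).inter (hEm t)),
        integral_indicator_one (hEm s), integral_indicator_one (hEm t), hp, hp]
      simp; ring
    rw [this]; exact hcor s t hst
  have hdiag : ∀ s, |∫ ω, u s ω * u s ω ∂μ| ≤ 1 := by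
    intro s
    have := norm_integral_le_of_norm_le_const (μ := μ) (f := fun ω => u s ω * u s ω) (C := 1)
      (ae_of_all _ fun ω => by
        rw [Real.norm_eq_abs, abs_mul]
        exact mul_le_one₀ (hub s ω) (abs_nonneg _) (hub s ω))
    simpa using this
  have hZ2 : ∫ ω, Z ω ^ 2 ∂μ ≤ θ ^ 2 * M ^ 2 := by
    have e : ∀ ω, Z ω ^ 2 = ∑ s ∈ Finset.range M, ∑ t ∈ Finset.range M,
        σ s * σ t * (u s ω * u t ω) := by
      intro ω
      simp only [Z]
      rw [sq, Finset.sum_mul_sum]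
      refine Finset.sum_congr rfl fun s _ => Finset.sum_congr rfl fun t _ => by ring
    simp_rw [e]
    rw [integral_finsetSum _ fun s _ => integrable_finsetSum _ fun t _ =>
      (huui s t).const_mul _]
    calc _ ≤ ∑ s ∈ Finset.range M, (1 + M * (θ ^ 2 / 2)) := by
          refine Finset.sum_le_sum fun s hs => ?_
          rw [integral_finsetSum _ fun t _ => (huui s t).const_mul _]
          calc _ ≤ ∑ t ∈ Finset.range M, ((if s = t then 1 else 0) + θ ^ 2 / 2) := by
                refine Finset.sum_le_sum fun t _ => ?_
                rw [integral_const_mul]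
                refine (le_abs_self _).trans ?_
                rw [abs_mul, abs_mul, hσ1, hσ1, one_mul, one_mul]
                split_ifs with hst
                · subst hst; have := hdiag s; nlinarith [sq_nonneg θ]
                · have := hcov s t hst; linarith
            _ = _ := by
                rw [Finset.sum_add_distrib, Finset.sum_ite_eq]
                simp [hs]
      _ = M + M ^ 2 * (θ ^ 2 / 2) := by simp; ring
      _ ≤ θ ^ 2 * M ^ 2 := by nlinarith
  -- the first absolute moment
  have hZ1 : ∫ ω, |Z ω| ∂μ ≤ θ * M := by
    have hθM : 0 < θ * M := mul_pos hθ hM0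
    have hpt : ∀ ω, |Z ω| ≤ θ * M / 2 + (1 / (2 * (θ * M))) * Z ω ^ 2 := by
      intro ω
      have h1 : 0 ≤ (|Z ω| - θ * M) ^ 2 := sq_nonneg _
      have h2 : |Z ω| ^ 2 = Z ω ^ 2 := sq_abs _
      have h3 : θ * M / 2 + (1 / (2 * (θ * M))) * Z ω ^ 2 - |Z ω|
          = (|Z ω| - θ * M) ^ 2 / (2 * (θ * M)) := by
        rw [← h2]; field_simp; ring
      have h4 : 0 ≤ (|Z ω| - θ * M) ^ 2 / (2 * (θ * M)) := by positivity
      linarith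
    calc ∫ ω, |Z ω| ∂μ ≤ ∫ ω, (θ * M / 2 + (1 / (2 * (θ * M))) * Z ω ^ 2) ∂μ :=
          integral_mono hZi.abs ((integrable_const _).add (hZ2i.const_mul _)) hpt
      _ = θ * M / 2 + (1 / (2 * (θ * M))) * ∫ ω, Z ω ^ 2 ∂μ := by
          rw [integral_add (integrable_const _) (hZ2i.const_mul _), integral_const_mul]
          simp
      _ ≤ θ * M / 2 + (1 / (2 * (θ * M))) * (θ ^ 2 * M ^ 2) := by gcongr
      _ = θ * M := by field_simp; ring
  -- conclusion
  have hZB : ∑ s ∈ Finset.range M, |μ.real (E s ∩ B) - p * μ.real B| = ∫ ω in B, Z ω ∂μ := by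
    simp only [Z]
    rw [integral_finsetSum _ fun s _ => ((hui s).const_mul _).restrict]
    refine Finset.sum_congr rfl fun s _ => ?_
    rw [hσ, integral_const_mul]
    congr 1
    simp only [u]
    rw [integral_sub (hindi s).restrict (integrable_const _), integral_indicator_one (hEm s),
      measureReal_restrict_apply (hEm s)]
    simp [mul_comm]
  rw [hZB]
  calc ∫ ω in B, Z ω ∂μ ≤ ∫ ω in B, |Z ω| ∂μ :=
        integral_mono hZi.restrict hZi.abs.restrict fun ω => le_abs_self _
    _ ≤ c * ∫ ω, |Z ω| ∂μ :=
        setIntegral_le_of_ratio hm hc h (measurable_abs_comp hZm) (fun ω => abs_nonneg _) hZi.abs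
    _ ≤ c * (θ * M) := by gcongr


/-! ### From a bounded dependence ratio and mixing to a ratio close to one -/

/-- The dependence ratio between events separated by a gap `m` is at most `κ`. -/
def RatioBd {Ω : Type*} [MeasurableSpace Ω] (μ : Measure Ω) (T : Ω → Ω) (χ : Ω → ℝ)
    (m : ℕ) (κ : ℝ) : Prop :=
  ∀ (a l : ℕ) (A B : Set Ω), MeasurableSet[winV T χ (Set.Iio a)] A →
    MeasurableSet[winV T χ (Set.Ico (a + m) l)] B →
    μ.real (A ∩ B) ≤ κ * μ.real A * μ.real B

theorem RatioBd.mono {Ω : Type*} [MeasurableSpace Ω] {μ : Measure Ω} {T : Ω → Ω} {χ : Ω → ℝ}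
    {m m' : ℕ} {κ κ' : ℝ} (h : RatioBd μ T χ m κ) (hm : m ≤ m') (hκ : κ ≤ κ') :
    RatioBd μ T χ m' κ' := by
  intro a l A B hA hB
  refine (h a l A B hA (winV_mono T χ (Set.Ico_subset_Ico_left (by omega)) _ hB)).trans ?_
  gcongr

theorem decor_shift {Ω : Type*} [MeasurableSpace Ω] {μ : Measure Ω} {T : Ω → Ω}
    (hT : MeasurePreserving T μ μ) {E : Set Ω} (hE : MeasurableSet E) {δ : ℝ} {n0 : ℕ}
    (h : ∀ n, n0 ≤ n → |μ.real (E ∩ T^[n] ⁻¹' E) - μ.real E ^ 2| ≤ δ) (q s t : ℕ) (hst : s ≠ t) :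
    |μ.real (T^[q + s * n0] ⁻¹' E ∩ T^[q + t * n0] ⁻¹' E) - μ.real E ^ 2| ≤ δ := by
  wlog hlt : s < t generalizing s t
  · rw [Set.inter_comm]; exact this t s hst.symm (by omega)
  obtain ⟨d, rfl⟩ := Nat.exists_eq_add_of_lt hlt
  have e : T^[q + s * n0] ⁻¹' E ∩ T^[q + (s + d + 1) * n0] ⁻¹' E
      = T^[q + s * n0] ⁻¹' (E ∩ T^[(d + 1) * n0] ⁻¹' E) := by
    ext ω
    have : q + (s + d + 1) * n0 = (d + 1) * n0 + (q + s * n0) := by ring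
    simp [this, Function.iterate_add_apply]
  rw [e, (hT.iterate _).measureReal_preimage
    (hE.inter ((hT.iterate _).measurable hE)).nullMeasurableSet]
  exact h _ (by nlinarith)

theorem ratio_arith {C κ η a b y z x xc pA pB pD ab i o : ℝ} (_hx0 : 0 ≤ x)
    (hpA' : 0 < a) (hpB' : 0 < b) (hC1 : 1 ≤ C)
    (hκ0 : 0 ≤ κ) (hη : 0 < η) (pA0 : 0 ≤ pA) (pB0 : 0 ≤ pB) (_y0 : 0 ≤ y) (z0 : 0 ≤ z)
    (yb : y ≤ (pA + η) * a) (zb : z ≤ (pB + η) * b) (xb : (pD - η) * b ≤ x)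
    (split1 : ab = i + o) (split2 : b = x + xc) (up : i ≤ κ * y * z)
    (out : o ≤ (C + η) * a * xc) (hAB : (C - η) * a * b < ab) :
    -2 * η + (C + η) * (pD - η) ≤ κ * (pA + η) * (pB + η) := by
  have yz : κ * y * z ≤ κ * ((pA + η) * a) * ((pB + η) * b) := by gcongr
  have hx : (C + η) * a * ((pD - η) * b) ≤ (C + η) * a * x := by gcongr
  have hdc : xc = b - x := by linarith
  subst hdc
  have hαβ : 0 < a * b := mul_pos hpA' hpB'
  refine le_of_mul_le_mul_right ?_ hαβ
  nlinarith

set_option maxHeartbeats 400000 in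
/-- The core estimate. -/
theorem ratio_core {Ω : Type*} [mΩ : MeasurableSpace Ω] {μ : Measure Ω} [IsProbabilityMeasure μ]
    {T : Ω → Ω} {χ : Ω → ℝ} (hT : MeasurePreserving T μ μ) (hχ : Measurable χ)
    (hmix : ∀ A : Set Ω, MeasurableSet A →
      Tendsto (fun n => μ.real (A ∩ T^[n] ⁻¹' A)) atTop (𝓝 (μ.real A ^ 2)))
    {r : ℕ} (hr : RatioBd μ T χ r 2) {C : ℝ} (hC1 : 1 ≤ C)
    (hC2 : ∀ ε > 0, ∃ m, RatioBd μ T χ m (C + ε))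
    (hC3 : ∀ m, ∀ ε > 0, ¬ RatioBd μ T χ m (C - ε))
    {κ : ℝ} {m0 : ℕ} (hκ0 : 0 ≤ κ) (hκ : RatioBd μ T χ m0 κ)
    {a1 l1 : ℕ} {A1 B1 : Set Ω} (hA1 : MeasurableSet[winV T χ (Set.Iio a1)] A1)
    (hB1 : MeasurableSet[winV T χ (Set.Ico (a1 + m0) l1)] B1) {η : ℝ} (hη : 0 < η) (hη1 : η < 1) :
    -2 * η + (C + η) * (μ.real (A1 ∩ B1) - η) ≤ κ * (μ.real A1 + η) * (μ.real B1 + η) := by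
  have hle : ∀ S, winV T χ S ≤ mΩ := fun S => winV_le hT.measurable hχ S
  have hA1m : MeasurableSet A1 := hle _ _ hA1
  have hB1m : MeasurableSet B1 := hle _ _ hB1
  set D1 := A1 ∩ B1 with hD1def
  have hD1m : MeasurableSet D1 := hA1m.inter hB1m
  obtain ⟨m1', hm1'⟩ := hC2 η hη
  obtain ⟨m1, hm1a, hm1b, hm1c⟩ : ∃ m1, m1' ≤ m1 ∧ r ≤ m1 ∧ m0 ≤ m1 :=
    ⟨max (max m1' r) m0, by omega, by omega, by omega⟩
  have hm1 : RatioBd μ T χ m1 (C + η) := hm1'.mono (by omega) le_rfl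
  have hm1r : RatioBd μ T χ m1 2 := hr.mono (by omega) le_rfl
  obtain ⟨θ, hθdef⟩ : ∃ θ : ℝ, θ = η / 6 := ⟨_, rfl⟩
  have hθ : 0 < θ := by rw [hθdef]; positivity
  have hdec : ∀ E : Set Ω, MeasurableSet E →
      ∀ᶠ n0 in atTop, ∀ n, n0 ≤ n → |μ.real (E ∩ T^[n] ⁻¹' E) - μ.real E ^ 2| ≤ θ ^ 2 / 2 := by
    intro E hE
    have h := (Metric.tendsto_atTop.1 (hmix E hE)) (θ ^ 2 / 2) (by positivity)
    obtain ⟨N, hN⟩ := h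
    filter_upwards [eventually_ge_atTop N] with n0 hn0 n hn
    have := hN n (hn0.trans hn)
    rw [Real.dist_eq] at this
    exact this.le
  obtain ⟨n0, hnA, hnB, hnD⟩ := ((hdec A1 hA1m).and ((hdec B1 hB1m).and (hdec D1 hD1m))).exists
  obtain ⟨M, hM⟩ := exists_nat_ge (2 / θ ^ 2)
  have hM2 : 2 ≤ θ ^ 2 * M := by
    rw [div_le_iff₀ (by positivity)] at hM; linarith
  have hMpos : 0 < M := by
    rcases Nat.eq_zero_or_pos M with h0 | h0
    · subst h0; norm_num at hM2
    · exact h0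
  have hM0 : (0 : ℝ) < M := by exact_mod_cast hMpos
  obtain ⟨e, hel, hea⟩ : ∃ e, l1 ≤ e ∧ a1 ≤ e := ⟨max l1 a1, by omega, by omega⟩
  obtain ⟨w, hwdef⟩ : ∃ w, w = M * n0 + e := ⟨_, rfl⟩
  have hnot := hC3 (m1 + w + m1) η hη
  unfold RatioBd at hnot
  push Not at hnot
  obtain ⟨a2, l2, A2, B2, hA2, hB2, hAB⟩ := hnot
  have hA2m : MeasurableSet A2 := hle _ _ hA2
  have hB2m : MeasurableSet B2 := hle _ _ hB2
  have hpA : 0 ≤ μ.real A2 := measureReal_nonneg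
  have hpB : 0 ≤ μ.real B2 := measureReal_nonneg
  have hCη : 0 < C - η := by linarith
  have hABle1 : μ.real (A2 ∩ B2) ≤ μ.real A2 := measureReal_mono Set.inter_subset_left
  have hABle2 : μ.real (A2 ∩ B2) ≤ μ.real B2 := measureReal_mono Set.inter_subset_right
  have hABpos : 0 < μ.real (A2 ∩ B2) := lt_of_le_of_lt (by positivity) hAB
  have hpA' : 0 < μ.real A2 := by linarith
  have hpB' : 0 < μ.real B2 := by linarith
  -- shifted events
  obtain ⟨sh, hsh⟩ : ∃ sh : ℕ → ℕ, ∀ s, sh s = a2 + m1 + s * n0 := ⟨_, fun _ => rfl⟩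
  have hwin : ∀ E : Set Ω, MeasurableSet[winV T χ (Set.Iio e)] E → ∀ s, s < M →
      MeasurableSet[winV T χ (Set.Ico (a2 + m1) (a2 + m1 + w))] (T^[sh s] ⁻¹' E) := by
    intro E hE s hs
    refine winV_preimage T χ (sh s) ?_ hE
    intro j hj
    have : s * n0 ≤ M * n0 := Nat.mul_le_mul_right _ hs.le
    have := hsh s
    simp only [Set.mem_Ico, Set.mem_Iio] at hj ⊢
    omega
  have hA1e : MeasurableSet[winV T χ (Set.Iio e)] A1 :=
    winV_mono T χ (Set.Iio_subset_Iio hea) _ hA1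
  have hB1e : MeasurableSet[winV T χ (Set.Iio e)] B1 :=
    winV_mono T χ (fun j hj => lt_of_lt_of_le hj.2 hel) _ hB1
  have hD1e : MeasurableSet[winV T χ (Set.Iio e)] D1 := MeasurableSet.inter hA1e hB1e
  have hrA : ∀ S, MeasurableSet[winV T χ (Set.Ico (a2 + m1) (a2 + m1 + w))] S →
      μ.real (S ∩ A2) ≤ (2 * μ.real A2) * μ.real S := by
    intro S hS
    rw [Set.inter_comm]
    exact hm1r a2 _ A2 S hA2 hS
  have hrB : ∀ S, MeasurableSet[winV T χ (Set.Ico (a2 + m1) (a2 + m1 + w))] S →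
      μ.real (S ∩ B2) ≤ (2 * μ.real B2) * μ.real S := by
    intro S hS
    have h1 := hm1r (a2 + m1 + w) l2 S B2
      (winV_mono T χ (fun j hj => hj.2) _ hS)
      (winV_mono T χ (Set.Ico_subset_Ico_left (by omega)) _ hB2)
    linarith [mul_right_comm 2 (μ.real S) (μ.real B2)]
  have hpres : ∀ E : Set Ω, MeasurableSet E → ∀ s, μ.real (T^[sh s] ⁻¹' E) = μ.real E :=
    fun E hE s => (hT.iterate _).measureReal_preimage hE.nullMeasurableSet
  have hmeas : ∀ E : Set Ω, MeasurableSet E → ∀ s, MeasurableSet (T^[sh s] ⁻¹' E) :=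
    fun E hE s => (hT.iterate _).measurable hE
  have sA := sum_abs_le_of_decor (hle _) hA2m (by positivity) hrA (fun s => T^[sh s] ⁻¹' A1)
    (hmeas A1 hA1m) (μ.real A1) (hpres A1 hA1m) M (hwin A1 hA1e) θ hθ hM2
    (fun s t hst => by simp only [hsh]; exact decor_shift hT hA1m hnA (a2 + m1) s t hst)
  have sB := sum_abs_le_of_decor (hle _) hB2m (by positivity) hrB (fun s => T^[sh s] ⁻¹' B1)
    (hmeas B1 hB1m) (μ.real B1) (hpres B1 hB1m) M (hwin B1 hB1e) θ hθ hM2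
    (fun s t hst => by simp only [hsh]; exact decor_shift hT hB1m hnB (a2 + m1) s t hst)
  have sD := sum_abs_le_of_decor (hle _) hB2m (by positivity) hrB (fun s => T^[sh s] ⁻¹' D1)
    (hmeas D1 hD1m) (μ.real D1) (hpres D1 hD1m) M (hwin D1 hD1e) θ hθ hM2
    (fun s t hst => by simp only [hsh]; exact decor_shift hT hD1m hnD (a2 + m1) s t hst)
  obtain ⟨s, hs, hsum⟩ : ∃ s ∈ Finset.range M,
      |μ.real (T^[sh s] ⁻¹' A1 ∩ A2) - μ.real A1 * μ.real A2| / μ.real A2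
      + |μ.real (T^[sh s] ⁻¹' B1 ∩ B2) - μ.real B1 * μ.real B2| / μ.real B2
      + |μ.real (T^[sh s] ⁻¹' D1 ∩ B2) - μ.real D1 * μ.real B2| / μ.real B2 ≤ η := by
    refine Finset.exists_le_of_sum_le (Finset.nonempty_range_iff.2 hMpos.ne') ?_
    rw [Finset.sum_add_distrib, Finset.sum_add_distrib, ← Finset.sum_div, ← Finset.sum_div,
      ← Finset.sum_div]
    have q1 := (div_le_div_iff_of_pos_right hpA').2 sA
    have q2 := (div_le_div_iff_of_pos_right hpB').2 sB
    have q3 := (div_le_div_iff_of_pos_right hpB').2 sD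
    have e1 : 2 * μ.real A2 * (θ * M) / μ.real A2 = 2 * (θ * M) := by field_simp
    have e2 : 2 * μ.real B2 * (θ * M) / μ.real B2 = 2 * (θ * M) := by field_simp
    rw [e1] at q1
    rw [e2] at q2 q3
    have e3 : ∑ i ∈ Finset.range M, η = 6 * (θ * M) := by rw [hθdef]; simp; ring
    rw [e3]
    linarith
  have hsM : s < M := Finset.mem_range.1 hs
  have nn1 : 0 ≤ |μ.real (T^[sh s] ⁻¹' A1 ∩ A2) - μ.real A1 * μ.real A2| / μ.real A2 := by positivity
  have nn2 : 0 ≤ |μ.real (T^[sh s] ⁻¹' B1 ∩ B2) - μ.real B1 * μ.real B2| / μ.real B2 := by positivity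
  have nn3 : 0 ≤ |μ.real (T^[sh s] ⁻¹' D1 ∩ B2) - μ.real D1 * μ.real B2| / μ.real B2 := by positivity
  have bA : |μ.real (T^[sh s] ⁻¹' A1 ∩ A2) - μ.real A1 * μ.real A2| ≤ η * μ.real A2 :=
    (div_le_iff₀ hpA').1 (by linarith)
  have bB : |μ.real (T^[sh s] ⁻¹' B1 ∩ B2) - μ.real B1 * μ.real B2| ≤ η * μ.real B2 :=
    (div_le_iff₀ hpB').1 (by linarith)
  have bD : |μ.real (T^[sh s] ⁻¹' D1 ∩ B2) - μ.real D1 * μ.real B2| ≤ η * μ.real B2 :=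
    (div_le_iff₀ hpB').1 (by linarith)
  have hDsm : MeasurableSet (T^[sh s] ⁻¹' D1) := hmeas D1 hD1m s
  have hDsAB : T^[sh s] ⁻¹' D1 = T^[sh s] ⁻¹' A1 ∩ T^[sh s] ⁻¹' B1 := rfl
  have hDsw := hwin D1 hD1e s hsM
  have hAsw : MeasurableSet[winV T χ (Set.Iio (sh s + a1))] (T^[sh s] ⁻¹' A1) := by
    refine winV_preimage T χ (sh s) ?_ hA1
    intro j hj; simp only [Set.mem_Iio] at hj ⊢; omega
  have hBsw : MeasurableSet[winV T χ (Set.Ico (sh s + a1 + m0) (sh s + l1))]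
      (T^[sh s] ⁻¹' B1) := by
    refine winV_preimage T χ (sh s) ?_ hB1
    intro j hj; simp only [Set.mem_Ico] at hj ⊢; omega
  generalize T^[sh s] ⁻¹' A1 = As at *
  generalize T^[sh s] ⁻¹' B1 = Bs at *
  generalize T^[sh s] ⁻¹' D1 = Ds at *
  have hsn : s * n0 ≤ M * n0 := Nat.mul_le_mul_right _ hsM.le
  -- upper bound through the inner pair
  have up : μ.real ((As ∩ A2) ∩ (Bs ∩ B2)) ≤ κ * μ.real (As ∩ A2) * μ.real (Bs ∩ B2) := by
    refine hκ (sh s + a1) (max l2 (sh s + l1)) _ _ ?_ ?_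
    · refine MeasurableSet.inter ?_ ?_
      · exact hAsw
      · refine winV_mono T χ (Set.Iio_subset_Iio ?_) _ hA2
        have := hsh s; omega
    · refine MeasurableSet.inter ?_ ?_
      · exact winV_mono T χ (Set.Ico_subset_Ico_right (le_max_right _ _)) _ hBsw
      · refine winV_mono T χ (Set.Ico_subset_Ico ?_ (le_max_left _ _)) _ hB2
        have := hsh s; omega
  have out : μ.real (A2 ∩ (Dsᶜ ∩ B2)) ≤ (C + η) * μ.real A2 * μ.real (Dsᶜ ∩ B2) := by
    refine hm1 a2 (max l2 (a2 + m1 + w)) _ _ hA2 (MeasurableSet.inter ?_ ?_)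
    · exact (winV_mono T χ (Set.Ico_subset_Ico_right (le_max_right _ _)) _
        hDsw).compl
    · exact winV_mono T χ (Set.Ico_subset_Ico (by omega) (le_max_left _ _)) _ hB2
  have split1 : μ.real (A2 ∩ B2) = μ.real ((As ∩ A2) ∩ (Bs ∩ B2)) + μ.real (A2 ∩ (Dsᶜ ∩ B2)) := by
    rw [← measureReal_inter_add_diff (s := A2 ∩ B2) hDsm]
    congr 2
    · rw [hDsAB]; ext ω; simp only [Set.mem_inter_iff]; tauto
    · ext ω; simp only [Set.mem_inter_iff, Set.mem_diff, Set.mem_compl_iff]; tauto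
  have split2 : μ.real B2 = μ.real (Ds ∩ B2) + μ.real (Dsᶜ ∩ B2) := by
    rw [← measureReal_inter_add_diff (s := B2) hDsm, Set.inter_comm, Set.diff_eq,
      Set.inter_comm B2 Dsᶜ]
  have y0 : 0 ≤ μ.real (As ∩ A2) := measureReal_nonneg
  have z0 : 0 ≤ μ.real (Bs ∩ B2) := measureReal_nonneg
  have yb : μ.real (As ∩ A2) ≤ (μ.real A1 + η) * μ.real A2 := by
    have := (abs_le.1 bA).2; linarith
  have zb : μ.real (Bs ∩ B2) ≤ (μ.real B1 + η) * μ.real B2 := by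
    have := (abs_le.1 bB).2; linarith
  have xb : (μ.real D1 - η) * μ.real B2 ≤ μ.real (Ds ∩ B2) := by
    have := (abs_le.1 bD).1; linarith
  have pA0 : 0 ≤ μ.real A1 := measureReal_nonneg
  have pB0 : 0 ≤ μ.real B1 := measureReal_nonneg
  exact ratio_arith measureReal_nonneg hpA' hpB' hC1 hκ0 hη pA0 pB0 y0 z0 yb zb xb split1 split2
    up out hAB

/-- Mixing together with a bounded dependence ratio forces the ratio to tend to one. -/
theorem exists_ratio_near_one {Ω : Type*} [mΩ : MeasurableSpace Ω] {μ : Measure Ω}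
    [IsProbabilityMeasure μ]
    {T : Ω → Ω} {χ : Ω → ℝ} (hT : MeasurePreserving T μ μ) (hχ : Measurable χ)
    (hmix : ∀ A : Set Ω, MeasurableSet A →
      Tendsto (fun n => μ.real (A ∩ T^[n] ⁻¹' A)) atTop (𝓝 (μ.real A ^ 2)))
    {r : ℕ} (hr : RatioBd μ T χ r 2) {δ : ℝ} (hδ : 0 < δ) :
    ∃ m, RatioBd μ T χ m (1 + δ) := by
  let S : Set ℝ := {κ | ∃ m, RatioBd μ T χ m κ}
  have hlow : ∀ κ ∈ S, 1 ≤ κ := by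
    rintro κ ⟨m, hm⟩
    simpa using hm 0 0 Set.univ Set.univ MeasurableSet.univ MeasurableSet.univ
  have hSne : S.Nonempty := ⟨2, r, hr⟩
  have hbdd : BddBelow S := ⟨1, hlow⟩
  set C := sInf S with hCdef
  have hC1 : 1 ≤ C := le_csInf hSne hlow
  have hC2 : ∀ ε > 0, ∃ m, RatioBd μ T χ m (C + ε) := by
    intro ε hε
    obtain ⟨κ, ⟨m, hm⟩, hκ⟩ := exists_lt_of_csInf_lt hSne (show sInf S < C + ε by linarith)
    exact ⟨m, hm.mono le_rfl hκ.le⟩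
  have hC3 : ∀ m, ∀ ε > 0, ¬ RatioBd μ T χ m (C - ε) := by
    intro m ε hε h
    have : C ≤ C - ε := csInf_le hbdd ⟨m, h⟩
    linarith
  have key : ∀ ε : ℝ, 0 < ε → ε < 1 → C * (C - ε) ≤ C + ε := by
    intro ε hε hε1
    obtain ⟨m0, hm0⟩ := hC2 ε hε
    have hnot := hC3 m0 ε hε
    unfold RatioBd at hnot
    push Not at hnot
    obtain ⟨a1, l1, A1, B1, hA1, hB1, hAB⟩ := hnot
    have hlim : C * μ.real (A1 ∩ B1) ≤ (C + ε) * μ.real A1 * μ.real B1 := by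
      have t1 : Tendsto (fun η : ℝ => -2 * η + (C + η) * (μ.real (A1 ∩ B1) - η)) (𝓝[>] 0)
          (𝓝 (C * μ.real (A1 ∩ B1))) := by
        have : Continuous (fun η : ℝ => -2 * η + (C + η) * (μ.real (A1 ∩ B1) - η)) := by fun_prop
        have h := (this.tendsto 0).mono_left (nhdsWithin_le_nhds (s := Set.Ioi 0))
        simpa using h
      have t2 : Tendsto (fun η : ℝ => (C + ε) * (μ.real A1 + η) * (μ.real B1 + η)) (𝓝[>] 0)
          (𝓝 ((C + ε) * μ.real A1 * μ.real B1)) := by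
        have : Continuous (fun η : ℝ => (C + ε) * (μ.real A1 + η) * (μ.real B1 + η)) := by fun_prop
        have h := (this.tendsto 0).mono_left (nhdsWithin_le_nhds (s := Set.Ioi 0))
        simpa using h
      refine le_of_tendsto_of_tendsto t1 t2 ?_
      filter_upwards [Ioo_mem_nhdsGT (show (0 : ℝ) < 1 by norm_num)] with η hη
      exact ratio_core hT hχ hmix hr hC1 hC2 hC3 (by linarith) hm0 hA1 hB1 hη.1 hη.2
    have hpA : 0 ≤ μ.real A1 := measureReal_nonneg
    have hpB : 0 ≤ μ.real B1 := measureReal_nonneg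
    have hle1 : μ.real (A1 ∩ B1) ≤ μ.real A1 := measureReal_mono Set.inter_subset_left
    have hle2 : μ.real (A1 ∩ B1) ≤ μ.real B1 := measureReal_mono Set.inter_subset_right
    have hCε : 0 < C - ε := by linarith
    have hpos : 0 < μ.real (A1 ∩ B1) := lt_of_le_of_lt (by positivity) hAB
    have hαβ : 0 < μ.real A1 * μ.real B1 := mul_pos (by linarith) (by linarith)
    refine le_of_mul_le_mul_right ?_ hαβ
    nlinarith
  have hfin : C * C ≤ C := by
    have t1 : Tendsto (fun η : ℝ => C * (C - η)) (𝓝[>] 0) (𝓝 (C * C)) := by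
      have : Continuous (fun η : ℝ => C * (C - η)) := by fun_prop
      have h := (this.tendsto 0).mono_left (nhdsWithin_le_nhds (s := Set.Ioi 0))
      simpa using h
    have t2 : Tendsto (fun η : ℝ => C + η) (𝓝[>] 0) (𝓝 C) := by
      have : Continuous (fun η : ℝ => C + η) := by fun_prop
      have h := (this.tendsto 0).mono_left (nhdsWithin_le_nhds (s := Set.Ioi 0))
      simpa using h
    refine le_of_tendsto_of_tendsto t1 t2 ?_
    filter_upwards [Ioo_mem_nhdsGT (show (0 : ℝ) < 1 by norm_num)] with η hη
    exact key η hη.1 hη.2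
  have hC : C ≤ 1 := by nlinarith
  obtain ⟨m, hm⟩ := hC2 δ hδ
  exact ⟨m, hm.mono le_rfl (by linarith)⟩


/-! ### An exponential bound for the number of exceedances -/

/-- Number of exceedances along an arithmetic progression. -/
noncomputable def cntCls {Ω : Type*} (T : Ω → Ω) (χ : Ω → ℝ) (x : ℝ) (d c q : ℕ) (ω : Ω) : ℕ :=
  ∑ i ∈ Finset.range q, if x < χ (T^[c + i * d] ω) then 1 else 0

theorem cntCls_succ {Ω : Type*} (T : Ω → Ω) (χ : Ω → ℝ) (x : ℝ) (d c q : ℕ) (ω : Ω) :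
    cntCls T χ x d c (q + 1) ω
      = cntCls T χ x d c q ω + if x < χ (T^[c + q * d] ω) then 1 else 0 :=
  Finset.sum_range_succ _ _

theorem cntCls_le {Ω : Type*} (T : Ω → Ω) (χ : Ω → ℝ) (x : ℝ) (d c q : ℕ) (ω : Ω) :
    cntCls T χ x d c q ω ≤ q := by
  induction q with
  | zero => simp [cntCls]
  | succ q ih => rw [cntCls_succ]; split_ifs <;> omega

theorem measurable_cntCls {Ω : Type*} (T : Ω → Ω) (χ : Ω → ℝ) (x : ℝ) (m c q : ℕ) :
    Measurable[winV T χ {j | j + m < c + q * (m + 1)}] (cntCls T χ x (m + 1) c q) := by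
  unfold cntCls
  refine Finset.measurable_fun_sum _ fun i hi => ?_
  refine Measurable.ite ?_ measurable_const measurable_const
  refine winV_gt T χ x ?_
  have hi' := Finset.mem_range.1 hi
  have : (i + 1) * (m + 1) ≤ q * (m + 1) := Nat.mul_le_mul_right _ hi'
  have e : (i + 1) * (m + 1) = i * (m + 1) + (m + 1) := by ring
  simp only [Set.mem_ofPred_eq]
  omega

theorem measurable_pow_cnt {Ω : Type*} {m : MeasurableSpace Ω} (y : ℝ) {f : Ω → ℕ}
    (hf : Measurable f) : Measurable fun ω => y ^ f ω :=
  (measurable_from_nat (f := fun k : ℕ => y ^ k)).comp hf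

theorem ratio_event {Ω : Type*} [mΩ : MeasurableSpace Ω] {μ : Measure Ω} [IsProbabilityMeasure μ]
    {T : Ω → Ω} {χ : Ω → ℝ} (hT : MeasurePreserving T μ μ) (hχ : Measurable χ)
    {m : ℕ} {κ : ℝ} (hR : RatioBd μ T χ m κ) (x : ℝ) (n : ℕ) {A : Set Ω}
    (hA : MeasurableSet[winV T χ {j | j + m < n}] A) :
    μ.real (A ∩ {ω | x < χ (T^[n] ω)}) ≤ (κ * μ.real {ω | x < χ ω}) * μ.real A := by
  have hle : ∀ S, winV T χ S ≤ mΩ := fun S => winV_le hT.measurable hχ S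
  have hAm := hle _ _ hA
  have hG : MeasurableSet[winV T χ (Set.Ico n (n + 1))] {ω | x < χ (T^[n] ω)} :=
    winV_gt T χ x (by simp)
  have hGm := hle _ _ hG
  have h := hR n (n + m + 1) (T^[m] ⁻¹' A) (T^[m] ⁻¹' {ω | x < χ (T^[n] ω)})
    (winV_preimage T χ m (fun j hj => hj) hA)
    (winV_preimage T χ m (fun j hj => by simp only [Set.mem_Ico] at hj ⊢; omega) hG)
  rw [← Set.preimage_inter,
    (hT.iterate m).measureReal_preimage (hAm.inter hGm).nullMeasurableSet,
    (hT.iterate m).measureReal_preimage hAm.nullMeasurableSet,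
    (hT.iterate m).measureReal_preimage hGm.nullMeasurableSet] at h
  have e : μ.real {ω | x < χ (T^[n] ω)} = μ.real {ω | x < χ ω} :=
    (hT.iterate n).measureReal_preimage (s := {ω | x < χ ω})
      (measurableSet_lt measurable_const hχ).nullMeasurableSet
  rw [e] at h
  linarith [mul_right_comm κ (μ.real A) (μ.real {ω | x < χ ω})]

theorem integrable_cls {Ω : Type*} [mΩ : MeasurableSpace Ω] {μ : Measure Ω}
    [IsProbabilityMeasure μ]
    {T : Ω → Ω} {χ : Ω → ℝ} (hT : MeasurePreserving T μ μ) (hχ : Measurable χ)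
    (m : ℕ) (x : ℝ) (c q : ℕ) {ε : ℝ} (hε : 0 ≤ ε) :
    Integrable (fun ω => (1 + ε) ^ cntCls T χ x (m + 1) c q ω) μ := by
  refine Integrable.of_bound (measurable_pow_cnt _ ((measurable_cntCls T χ x m c q).mono
    (winV_le hT.measurable hχ _) le_rfl)).aestronglyMeasurable ((1 + ε) ^ q)
    (ae_of_all _ fun ω => ?_)
  rw [Real.norm_eq_abs, abs_of_nonneg (by positivity)]
  exact pow_le_pow_right₀ (by linarith) (cntCls_le T χ x (m + 1) c q ω)

theorem integral_cls_le {Ω : Type*} [mΩ : MeasurableSpace Ω] {μ : Measure Ω}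
    [IsProbabilityMeasure μ]
    {T : Ω → Ω} {χ : Ω → ℝ} (hT : MeasurePreserving T μ μ) (hχ : Measurable χ)
    {m : ℕ} {κ : ℝ} (hκ : 0 ≤ κ) (hR : RatioBd μ T χ m κ) (x : ℝ) (c q : ℕ) {ε : ℝ} (hε : 0 ≤ ε) :
    ∫ ω, (1 + ε) ^ cntCls T χ x (m + 1) c q ω ∂μ
      ≤ Real.exp (q * (ε * (κ * μ.real {ω | x < χ ω}))) := by
  have hle : ∀ S, winV T χ S ≤ mΩ := fun S => winV_le hT.measurable hχ S
  have hp : 0 ≤ μ.real {ω | x < χ ω} := measureReal_nonneg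
  induction q with
  | zero => simp [cntCls]
  | succ q ih =>
    set n := c + q * (m + 1) with hn
    set G : Set Ω := {ω | x < χ (T^[n] ω)} with hGdef
    have hGm : MeasurableSet G := hle _ _ (winV_gt T χ x (S := Set.univ) (Set.mem_univ n))
    have hIntg := integrable_cls (μ := μ) hT hχ m x c q hε
    have e : ∀ ω, (1 + ε) ^ cntCls T χ x (m + 1) c (q + 1) ω
        = (1 + ε) ^ cntCls T χ x (m + 1) c q ω
          + ε * G.indicator (fun ω => (1 + ε) ^ cntCls T χ x (m + 1) c q ω) ω := by
      intro ω
      rw [cntCls_succ]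
      by_cases hω : x < χ (T^[n] ω)
      · have : ω ∈ G := hω
        rw [if_pos hω, Set.indicator_of_mem this, pow_succ]; ring
      · have : ω ∉ G := hω
        rw [if_neg hω, Set.indicator_of_notMem this]; simp
    simp_rw [e]
    rw [integral_add hIntg ((hIntg.indicator hGm).const_mul ε), integral_const_mul,
      integral_indicator hGm]
    have hstep := setIntegral_le_of_ratio (hle {j | j + m < n}) (μ := μ) (B := G)
      (mul_nonneg hκ hp) (fun S hS => ratio_event hT hχ hR x n hS)
      (measurable_pow_cnt (1 + ε) (measurable_cntCls T χ x m c q))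
      (fun ω => by positivity) hIntg
    have hI : 0 ≤ ∫ ω, (1 + ε) ^ cntCls T χ x (m + 1) c q ω ∂μ :=
      integral_nonneg fun ω => by positivity
    set I := ∫ ω, (1 + ε) ^ cntCls T χ x (m + 1) c q ω ∂μ with hIdef
    set v := ε * (κ * μ.real {ω | x < χ ω}) with hv
    have hv0 : 0 ≤ v := by positivity
    calc _ ≤ I + ε * (κ * μ.real {ω | x < χ ω} * I) := by gcongr
      _ = I * (1 + v) := by rw [hv]; ring
      _ ≤ Real.exp (q * v) * Real.exp v := by
          gcongr
          linarith [Real.add_one_le_exp v]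
      _ = _ := by rw [← Real.exp_add]; congr 1; push_cast; ring

theorem sum_range_mul_cls (g : ℕ → ℕ) (d q : ℕ) :
    ∑ j ∈ Finset.range (q * d), g j
      = ∑ c ∈ Finset.range d, ∑ i ∈ Finset.range q, g (c + i * d) := by
  induction q with
  | zero => simp
  | succ q ih =>
    rw [Nat.succ_mul, Finset.sum_range_add, ih, ← Finset.sum_add_distrib]
    refine Finset.sum_congr rfl fun c _ => ?_
    rw [Finset.sum_range_succ, add_comm c (q * d)]

theorem count_le_cls {Ω : Type*} (T : Ω → Ω) (χ : Ω → ℝ) (x : ℝ) (n d : ℕ) (hd : 0 < d) (ω : Ω) :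
    ((Finset.Icc 1 n).filter fun j => x < χ (T^[j - 1] ω)).card
      ≤ ∑ c ∈ Finset.range d, cntCls T χ x d c (n / d + 1) ω := by
  unfold cntCls
  rw [← sum_range_mul_cls (fun j => if x < χ (T^[j] ω) then 1 else 0)]
  have h1 : ((Finset.Icc 1 n).filter fun j => x < χ (T^[j - 1] ω)).card
      = ∑ j ∈ Finset.range n, if x < χ (T^[j] ω) then 1 else 0 := by
    rw [Finset.card_filter, ← Finset.Ico_add_one_right_eq_Icc, Finset.sum_Ico_eq_sum_range]
    refine Finset.sum_congr (by simp) fun j _ => ?_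
    simp
  rw [h1]
  refine Finset.sum_le_sum_of_subset (Finset.range_mono ?_)
  have := Nat.lt_mul_div_succ n hd
  rw [mul_comm] at this
  exact this.le

theorem count_bound {Ω : Type*} [mΩ : MeasurableSpace Ω] {μ : Measure Ω}
    [IsProbabilityMeasure μ]
    {T : Ω → Ω} {χ : Ω → ℝ} (hT : MeasurePreserving T μ μ) (hχ : Measurable χ)
    {m : ℕ} {κ : ℝ} (hκ : 0 ≤ κ) (hR : RatioBd μ T χ m κ) (x : ℝ) (n : ℕ) (t : ℝ)
    {ε : ℝ} (hε : 0 ≤ ε) :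
    μ.real {ω | t < (((Finset.Icc 1 n).filter fun j => x < χ (T^[j - 1] ω)).card : ℝ)}
      ≤ (m + 1 : ℝ) * Real.exp (((n / (m + 1) + 1 : ℕ) : ℝ) * (ε * (κ * μ.real {ω | x < χ ω}))
          - t / (m + 1) * Real.log (1 + ε)) := by
  set q := n / (m + 1) + 1 with hq
  have hm1 : (0 : ℝ) < m + 1 := by positivity
  set y := t / (m + 1) * Real.log (1 + ε) with hy
  have hlog : 0 ≤ Real.log (1 + ε) := Real.log_nonneg (by linarith)
  have hsub : {ω | t < (((Finset.Icc 1 n).filter fun j => x < χ (T^[j - 1] ω)).card : ℝ)}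
      ⊆ ⋃ c ∈ Finset.range (m + 1),
        {ω | Real.exp y ≤ (1 + ε) ^ cntCls T χ x (m + 1) c q ω} := by
    intro ω hω
    simp only [Set.mem_ofPred_eq] at hω
    have h1 := count_le_cls T χ x n (m + 1) (Nat.succ_pos m) ω
    have h2 : (((Finset.Icc 1 n).filter fun j => x < χ (T^[j - 1] ω)).card : ℝ)
        ≤ ∑ c ∈ Finset.range (m + 1), (cntCls T χ x (m + 1) c q ω : ℝ) := by exact_mod_cast h1
    have h3 : ∑ c ∈ Finset.range (m + 1), t / (m + 1)
        < ∑ c ∈ Finset.range (m + 1), (cntCls T χ x (m + 1) c q ω : ℝ) := by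
      refine lt_of_eq_of_lt ?_ (hω.trans_le h2)
      simp; field_simp
    obtain ⟨c, hc, hlt⟩ := Finset.exists_lt_of_sum_lt h3
    simp only [Set.mem_iUnion]
    refine ⟨c, hc, ?_⟩
    have hpos : (0 : ℝ) < 1 + ε := by linarith
    simp only [Set.mem_ofPred_eq]
    rw [← Real.exp_log (pow_pos hpos (cntCls T χ x (m + 1) c q ω)), Real.log_pow]
    exact Real.exp_le_exp.2 (mul_le_mul_of_nonneg_right hlt.le hlog)
  have hone : ∀ c, μ.real {ω | Real.exp y ≤ (1 + ε) ^ cntCls T χ x (m + 1) c q ω}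
      ≤ Real.exp ((q : ℝ) * (ε * (κ * μ.real {ω | x < χ ω})) - y) := by
    intro c
    have h1 := mul_meas_ge_le_integral_of_nonneg (μ := μ)
      (f := fun ω => (1 + ε) ^ cntCls T χ x (m + 1) c q ω)
      (ae_of_all _ fun ω => by positivity) (integrable_cls hT hχ m x c q hε) (Real.exp y)
    have h2 := h1.trans (integral_cls_le hT hχ hκ hR x c q hε)
    rw [Real.exp_sub, le_div_iff₀ (Real.exp_pos _), mul_comm]
    exact h2
  calc _ ≤ μ.real (⋃ c ∈ Finset.range (m + 1),
        {ω | Real.exp y ≤ (1 + ε) ^ cntCls T χ x (m + 1) c q ω}) :=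
        measureReal_mono hsub (measure_ne_top _ _)
    _ ≤ ∑ c ∈ Finset.range (m + 1),
        μ.real {ω | Real.exp y ≤ (1 + ε) ^ cntCls T χ x (m + 1) c q ω} :=
        measureReal_biUnion_finset_le _ _
    _ ≤ ∑ c ∈ Finset.range (m + 1),
        Real.exp ((q : ℝ) * (ε * (κ * μ.real {ω | x < χ ω})) - y) :=
        Finset.sum_le_sum fun c _ => hone c
    _ = _ := by simp


/-! ### The mixing coefficient, the tail, and the conclusion -/

theorem ratioBd_of_psi {Ω : Type*} [mΩ : MeasurableSpace Ω] {μ : Measure Ω}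
    [IsProbabilityMeasure μ] {T : Ω → Ω} {χ : Ω → ℝ} {r : ℕ} (hrψ : psiCoeff μ T χ r < 1) :
    RatioBd μ T χ r 2 := by
  intro a l A B hA hB
  have hpA : 0 ≤ μ.real A := measureReal_nonneg
  have hpB : 0 ≤ μ.real B := measureReal_nonneg
  have hA' : MeasurableSet[sigmaIcc T χ 1 (max a 1)] A := by
    have h : winV T χ (Set.Iio a) ≤ sigmaIcc T χ 1 (max a 1) := by
      refine iSup₂_le fun j hj => ?_
      have hj' : j < a := hj
      exact le_iSup₂ (f := fun k (_ : k ∈ Set.Icc 1 (max a 1)) =>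
        MeasurableSpace.comap (fun ω => χ (T^[k - 1] ω)) inferInstance) (j + 1)
        ⟨by omega, by omega⟩
    exact h A hA
  have hB' : MeasurableSet[sigmaIci T χ (max a 1 + r)] B := by
    have h : winV T χ (Set.Ico (a + r) l) ≤ sigmaIci T χ (max a 1 + r) := by
      refine iSup₂_le fun j hj => ?_
      have hj' : a + r ≤ j := hj.1
      exact le_iSup₂ (f := fun k (_ : k ∈ Set.Ici (max a 1 + r)) =>
        MeasurableSpace.comap (fun ω => χ (T^[k - 1] ω)) inferInstance) (j + 1)
        (show max a 1 + r ≤ j + 1 by omega)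
    exact h B hB
  rcases eq_or_ne (μ A) 0 with hA0 | hA0
  · have : μ.real (A ∩ B) ≤ μ.real A := measureReal_mono Set.inter_subset_left
    have h0 : μ.real A = 0 := by simp [measureReal_def, hA0]
    rw [h0] at this ⊢; linarith
  rcases eq_or_ne (μ B) 0 with hB0 | hB0
  · have : μ.real (A ∩ B) ≤ μ.real B := measureReal_mono Set.inter_subset_right
    have h0 : μ.real B = 0 := by simp [measureReal_def, hB0]
    rw [h0] at this ⊢; linarith
  have hAp : 0 < μ.real A := ENNReal.toReal_pos hA0 (measure_ne_top _ _)
  have hBp : 0 < μ.real B := ENNReal.toReal_pos hB0 (measure_ne_top _ _)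
  have h1 : ENNReal.ofReal |(μ (A ∩ B)).toReal / ((μ A).toReal * (μ B).toReal) - 1|
      ≤ psiCoeff μ T χ r := by
    unfold psiCoeff
    refine le_trans ?_ (le_iSup₂ (f := fun k (_ : 1 ≤ k) =>
      psiDep μ (sigmaIcc T χ 1 k) (sigmaIci T χ (k + r))) (max a 1) (le_max_right _ _))
    unfold psiDep
    refine le_trans ?_ (le_iSup _ A)
    refine le_trans ?_ (le_iSup _ B)
    refine le_trans ?_ (le_iSup _ hA')
    refine le_trans ?_ (le_iSup _ hB')
    refine le_trans ?_ (le_iSup _ (pos_iff_ne_zero.2 hA0))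
    exact le_iSup (fun _ : 0 < μ B =>
      ENNReal.ofReal |(μ (A ∩ B)).toReal / ((μ A).toReal * (μ B).toReal) - 1|)
      (pos_iff_ne_zero.2 hB0)
  have h2 := ENNReal.ofReal_lt_one.1 (h1.trans_lt hrψ)
  have h3 := (abs_lt.1 h2).2
  have h4 : μ.real (A ∩ B) / (μ.real A * μ.real B) < 2 := by
    simp only [measureReal_def]; linarith
  rw [div_lt_iff₀ (mul_pos hAp hBp)] at h4
  linarith

theorem tail_bound {Ω : Type*} [mΩ : MeasurableSpace Ω] {μ : Measure Ω}
    [IsProbabilityMeasure μ] {χ : Ω → ℝ} (hχ : Measurable χ)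
    (L : ℝ → ℝ) (hL : SlowlyVarying L) (hLpos : ∀ x : ℝ, 0 < x → 0 < L x)
    {α : ℝ} (hα0 : 0 < α)
    (htail : ∀ x : ℝ, 0 < x → μ.real {ω | x < χ ω} = L x / x ^ α)
    (b : ℕ → ℕ) (hb : Tendsto b atTop atTop)
    (hbo : Tendsto (fun n => (b n : ℝ) / (n : ℝ)) atTop (𝓝 0)) :
    ∃ ρ : ℝ, 0 < ρ ∧ ρ < 1 ∧ ∀ᶠ n : ℕ in atTop, ∀ k : ℕ, 2 ≤ k →
      n * μ.real {ω | 2 ^ (k - 1) * gSeq μ χ b n < χ ω} ≤ ρ * b n := by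
  have hc1 : ((4 : ℝ) / 3) ^ (-α) < 1 := Real.rpow_lt_one_of_one_lt_of_neg (by norm_num) (by linarith)
  have hc0 : 0 < ((4 : ℝ) / 3) ^ (-α) := Real.rpow_pos_of_pos (by norm_num) _
  refine ⟨(((4 : ℝ) / 3) ^ (-α) + 1) / 2, by linarith, by linarith, ?_⟩
  set ρ : ℝ := (((4 : ℝ) / 3) ^ (-α) + 1) / 2 with hρ
  have hcomp : ∀ x, μ.real {ω | χ ω ≤ x} = 1 - μ.real {ω | x < χ ω} := by
    intro x
    have e : {ω | χ ω ≤ x} = {ω | x < χ ω}ᶜ := by ext ω; simp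
    rw [e, probReal_compl_eq_one_sub (measurableSet_lt measurable_const hχ)]
  -- comparison of tails
  have hev : ∀ᶠ x : ℝ in atTop, L (4 / 3 * x) / L x * ((4 : ℝ) / 3) ^ (-α) < ρ := by
    have h := (hL (4 / 3) (by norm_num)).mul_const (((4 : ℝ) / 3) ^ (-α))
    exact h.eventually (gt_mem_nhds (by linarith))
  obtain ⟨x0, hx0⟩ := (hev.and (eventually_ge_atTop 1)).exists_forall_of_atTop
  have hx01 : 1 ≤ x0 := (hx0 x0 le_rfl).2
  have hcmp : ∀ x, x0 ≤ x → μ.real {ω | 4 / 3 * x < χ ω} ≤ ρ * μ.real {ω | x < χ ω} := by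
    intro x hx
    have hxp : 0 < x := by linarith
    have h1 := (hx0 x hx).1
    rw [htail _ (by positivity), htail _ hxp, Real.mul_rpow (by norm_num) hxp.le]
    rw [Real.rpow_neg (by norm_num)] at h1
    have hLx := hLpos x hxp
    have hxα : 0 < x ^ α := Real.rpow_pos_of_pos hxp _
    have h43 : 0 < ((4 : ℝ) / 3) ^ α := Real.rpow_pos_of_pos (by norm_num) _
    have e : L (4 / 3 * x) / (((4 : ℝ) / 3) ^ α * x ^ α)
        = (L (4 / 3 * x) / L x * (((4 : ℝ) / 3) ^ α)⁻¹) * (L x / x ^ α) := by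
      field_simp
    rw [e]
    gcongr
  have hx0tail : 0 < μ.real {ω | x0 < χ ω} := by
    rw [htail x0 (by linarith)]
    exact div_pos (hLpos _ (by linarith)) (Real.rpow_pos_of_pos (by linarith) _)
  -- the distribution function tends to one
  have hlim : Tendsto (fun N : ℕ => μ.real {ω | χ ω ≤ N}) atTop (𝓝 1) := by
    have h := tendsto_measure_iUnion_atTop (μ := μ) (s := fun N : ℕ => {ω | χ ω ≤ N})
      (fun i j hij ω hω =>
        show χ ω ≤ (j : ℝ) from le_trans (show χ ω ≤ (i : ℝ) from hω) (Nat.cast_le.2 hij))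
    have hU : (⋃ N : ℕ, {ω | χ ω ≤ N}) = Set.univ := by
      ext ω; simpa using exists_nat_ge (χ ω)
    rw [hU, measure_univ] at h
    have := (ENNReal.tendsto_toReal ENNReal.one_ne_top).comp h
    rw [ENNReal.toReal_one] at this
    exact this
  filter_upwards [hb.eventually_ge_atTop 2, eventually_gt_atTop 0,
    hbo.eventually (gt_mem_nhds hx0tail)] with n hb2 hn0 hsmall k hk
  have hn : (0 : ℝ) < n := by exact_mod_cast hn0
  have hbR : (2 : ℝ) ≤ b n := by exact_mod_cast hb2
  have hζ : ((b n : ℝ)) ^ ((2 : ℝ) / 3) < b n := by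
    conv_rhs => rw [← Real.rpow_one (b n : ℝ)]
    exact Real.rpow_lt_rpow_of_exponent_lt (by linarith) (by norm_num)
  have hζ0 : 0 ≤ ((b n : ℝ)) ^ ((2 : ℝ) / 3) := by positivity
  set v := ((b n : ℝ) - (b n : ℝ) ^ ((2 : ℝ) / 3)) / n with hv
  have hv0 : 0 < v := div_pos (by linarith) hn
  have hvb : v ≤ b n / n := by rw [hv]; gcongr; linarith
  set g := gSeq μ χ b n with hg
  have hgdef : g = sInf {x : ℝ | 1 - v ≤ μ.real {ω | χ ω ≤ x}} := rfl
  have hne : {x : ℝ | 1 - v ≤ μ.real {ω | χ ω ≤ x}}.Nonempty := by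
    obtain ⟨N, hN⟩ := (hlim.eventually (lt_mem_nhds (show 1 - v < 1 by linarith))).exists
    exact ⟨N, hN.le⟩
  have hlow : ∀ x ∈ {x : ℝ | 1 - v ≤ μ.real {ω | χ ω ≤ x}}, x0 ≤ x := by
    intro x hx
    by_contra hlt
    have hx' : 1 - v ≤ μ.real {ω | χ ω ≤ x} := hx
    rw [hcomp] at hx'
    have hmono : μ.real {ω | x0 < χ ω} ≤ μ.real {ω | x < χ ω} :=
      measureReal_mono (fun ω hω => lt_trans (not_le.1 hlt) hω)
    linarith
  have hgx0 : x0 ≤ g := by rw [hgdef]; exact le_csInf hne hlow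
  have hgt : ∀ x, g < x → μ.real {ω | x < χ ω} ≤ b n / n := by
    intro x hx
    rw [hgdef] at hx
    obtain ⟨z, hz, hzx⟩ := exists_lt_of_csInf_lt hne hx
    have hz' : 1 - v ≤ μ.real {ω | χ ω ≤ z} := hz
    rw [hcomp] at hz'
    have hmono : μ.real {ω | x < χ ω} ≤ μ.real {ω | z < χ ω} :=
      measureReal_mono (fun ω hω => lt_trans hzx hω)
    linarith
  have hgpos : 0 < g := by linarith
  have hpow : (2 : ℝ) ≤ 2 ^ (k - 1) := by
    calc (2 : ℝ) = 2 ^ 1 := by norm_num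
      _ ≤ 2 ^ (k - 1) := pow_le_pow_right₀ (by norm_num) (by omega)
  have h1 : μ.real {ω | 2 ^ (k - 1) * g < χ ω} ≤ μ.real {ω | 4 / 3 * (3 / 2 * g) < χ ω} := by
    refine measureReal_mono (fun ω hω => ?_)
    have hω2 : 2 ^ (k - 1) * g < χ ω := hω
    show 4 / 3 * (3 / 2 * g) < χ ω
    nlinarith
  have h2 := hcmp (3 / 2 * g) (by linarith)
  have h3 := hgt (3 / 2 * g) (by linarith)
  have h4 : μ.real {ω | 2 ^ (k - 1) * g < χ ω} ≤ ρ * (b n / n) := by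
    refine h1.trans (h2.trans ?_)
    have : 0 ≤ ρ := by linarith
    gcongr
  calc (n : ℝ) * μ.real {ω | 2 ^ (k - 1) * g < χ ω} ≤ n * (ρ * (b n / n)) := by gcongr
    _ = ρ * b n := by field_simp


theorem Phi_kn_exponential_bound
    {Ω : Type*} [MeasurableSpace Ω] (T : Ω → Ω) (μ : Measure Ω)
    {F : Type*} [NormedRing F] [NormedAlgebra ℝ F] [CompleteSpace F]
    (ι : F →ₐ[ℝ] Ω → ℝ) (χ : Ω → ℝ)
    (hD : PropertyD T μ ι χ)
    (L : ℝ → ℝ) (hL : SlowlyVarying L) (hLpos : ∀ x : ℝ, 0 < x → 0 < L x)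
    {α : ℝ} (hα0 : 0 < α) (hα1 : α < 1)
    (htail : ∀ x : ℝ, 0 < x → (μ {ω | x < χ ω}).toReal = L x / x ^ α)
    (b : ℕ → ℕ) (hb : Tendsto b atTop atTop)
    (hbo : Tendsto (fun n => (b n : ℝ) / (n : ℝ)) atTop (𝓝 0))
    (r : ℕ) (hr1 : 1 ≤ r) (hrψ : psiCoeff μ T χ r < 1)
    (hrmin : ∀ m : ℕ, 1 ≤ m → m < r → 1 ≤ psiCoeff μ T χ m)
    :
    ∃ K : ℝ, 0 < K ∧ ∃ W : ℝ, 0 < W ∧ ∃ N : ℕ, ∀ n ≥ N, ∀ k : ℕ, 2 ≤ k →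
      (μ {ω | (b n : ℝ) - 2 * r + 1 <
        (((Finset.Icc 1 n).filter fun j =>
          2 ^ (k - 1) * gSeq μ χ b n < χ (T^[j - 1] ω)).card : ℝ)}).toReal ≤
      K * Real.exp (-W * (b n : ℝ)) := by
  haveI := hD.prob
  have hT := hD.invariant
  have hχ := hD.chi_meas
  have hmix : ∀ A : Set Ω, MeasurableSet A →
      Tendsto (fun n => μ.real (A ∩ T^[n] ⁻¹' A)) atTop (𝓝 (μ.real A ^ 2)) := by
    intro A hA
    have h := (ENNReal.tendsto_toReal (ENNReal.mul_ne_top (measure_ne_top μ A)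
      (measure_ne_top μ A))).comp (hD.mixing A A hA hA)
    rw [ENNReal.toReal_mul, ← sq] at h
    exact h
  obtain ⟨ρ, hρ0, hρ1, htb⟩ := tail_bound hχ L hL hLpos hα0 htail b hb hbo
  obtain ⟨ε, hε⟩ : ∃ ε : ℝ, ε = (1 - ρ) / 4 := ⟨_, rfl⟩
  have hε0 : 0 < ε := by rw [hε]; linarith
  have hε1 : ε < 1 := by rw [hε]; linarith
  obtain ⟨m, hm⟩ := exists_ratio_near_one hT hχ hmix (ratioBd_of_psi hrψ) hε0
  have hm1 : (0 : ℝ) < m + 1 := by positivity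
  obtain ⟨N, hN⟩ := eventually_atTop.1 (htb.and (hb.eventually_ge_atTop (2 * r)))
  refine ⟨(m + 1) * Real.exp (ε / (m + 1) * (2 * r) + ε * (1 + ε)), by positivity,
    ε / (m + 1) * ((1 - ρ) / 2), by
      have : 0 < 1 - ρ := by linarith
      positivity, N, ?_⟩
  intro n hn k hk
  obtain ⟨htn, hbn⟩ := hN n hn
  have hnp := htn k hk
  have hbR : (2 : ℝ) * r ≤ b n := by exact_mod_cast hbn
  have hcb := count_bound hT hχ (by linarith : (0 : ℝ) ≤ 1 + ε) hm (2 ^ (k - 1) * gSeq μ χ b n) n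
    ((b n : ℝ) - 2 * r + 1) hε0.le
  refine hcb.trans ?_
  rw [mul_assoc, ← Real.exp_add]
  refine mul_le_mul_of_nonneg_left (Real.exp_le_exp.2 ?_) hm1.le
  have hp0 : 0 ≤ μ.real {ω | 2 ^ (k - 1) * gSeq μ χ b n < χ ω} := measureReal_nonneg
  have hp1 : μ.real {ω | 2 ^ (k - 1) * gSeq μ χ b n < χ ω} ≤ 1 := measureReal_le_one
  generalize μ.real {ω | 2 ^ (k - 1) * gSeq μ χ b n < χ ω} = p at *
  have hq : ((n / (m + 1) + 1 : ℕ) : ℝ) ≤ n / (m + 1) + 1 := by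
    push_cast
    have := Nat.cast_div_le (α := ℝ) (m := n) (n := m + 1)
    push_cast at this
    linarith
  have hlog : ε * (1 - ε) ≤ Real.log (1 + ε) := by
    have h1 := Real.one_sub_inv_le_log_of_pos (show 0 < 1 + ε by linarith)
    have h2 : ε * (1 - ε) ≤ 1 - (1 + ε)⁻¹ := by
      have : 1 - (1 + ε)⁻¹ = ε / (1 + ε) := by field_simp; ring
      rw [this, le_div_iff₀ (by linarith)]
      nlinarith [pow_pos hε0 3]
    linarith
  have ht0 : 0 ≤ ((b n : ℝ) - 2 * r + 1) / (m + 1) := div_nonneg (by linarith) hm1.le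
  have hA : ((b n : ℝ) - 2 * r + 1) / (m + 1) * (ε * (1 - ε))
      ≤ ((b n : ℝ) - 2 * r + 1) / (m + 1) * Real.log (1 + ε) := by gcongr
  have hB : ((n / (m + 1) + 1 : ℕ) : ℝ) * (ε * ((1 + ε) * p))
      ≤ ((n : ℝ) / (m + 1) + 1) * (ε * ((1 + ε) * p)) := by gcongr
  have hB2 : ((n : ℝ) / (m + 1) + 1) * (ε * ((1 + ε) * p))
      ≤ ε / (m + 1) * ((1 + ε) * (ρ * b n)) + ε * (1 + ε) := by
    have e : ((n : ℝ) / (m + 1) + 1) * (ε * ((1 + ε) * p))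
        = ε / (m + 1) * ((1 + ε) * (n * p)) + ε * (1 + ε) * p := by field_simp
    rw [e]
    have h1 : ε / (m + 1) * ((1 + ε) * (n * p)) ≤ ε / (m + 1) * ((1 + ε) * (ρ * b n)) := by
      gcongr
    have h2 : ε * (1 + ε) * p ≤ ε * (1 + ε) * 1 := by gcongr
    linarith
  have hC : ((b n : ℝ) - 2 * r + 1) / (m + 1) * (ε * (1 - ε))
      = ε / (m + 1) * ((1 - ε) * ((b n : ℝ) - 2 * r + 1)) := by field_simp
  have hd : 0 ≤ ε / ((m : ℝ) + 1) := by positivity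
  have hfin : (1 + ε) * (ρ * b n) - (1 - ε) * ((b n : ℝ) - 2 * r + 1)
      ≤ 2 * r - (1 - ρ) / 2 * b n := by
    have hb0 : (0 : ℝ) ≤ b n := by positivity
    have hr0 : (0 : ℝ) ≤ r := by positivity
    have h1 : ((1 + ε) * ρ - (1 - ε)) ≤ - ((1 - ρ) / 2) := by
      have : ε * ρ ≤ ε := by nlinarith
      have h4 : 4 * ε = 1 - ρ := by rw [hε]; ring
      nlinarith
    have h2 := mul_le_mul_of_nonneg_right h1 hb0
    nlinarith
  have hfin2 := mul_le_mul_of_nonneg_left hfin hd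
  rw [mul_sub, mul_sub] at hfin2
  have e3 : -(ε / ((m : ℝ) + 1) * ((1 - ρ) / 2)) * (b n : ℝ)
      = -(ε / (m + 1) * ((1 - ρ) / 2 * b n)) := by ring
  rw [e3]
  linarith
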